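/- arXiv:0906.1560 — 3 statements merged into one kernel-verified Lean document; each statement's English description precedes it below -/
import Mathlib

section
/- Given a three-dimensional conformal structure on U ⊆ ℝ^V for a tetrahedron collection 𝒯, let f : (−ε, ε) → U be a smooth curve and let EHR(t) = Σ_{edges {i,j}} (2π − Σ_{{i,j,k,l} ∈ 𝒯} β_{ij,kl}) ℓ_ij evaluated at f(t). Then at t = 0, (d²/dt²) EHR = Σ_{i ∈ V} Σ_{j : {i,j} an edge} (ℓ*_ij/ℓ_ij − (q_ij/(2 ℓ_ij)) K_ij)(f_j′ − f_i′)² + Σ_{i ∈ V} K_i ((f_i′)² + f_i″). In particular, if K_ij = 0 for every edge {i,j} (the Ricci flat case), then (d²/dt²) EHR = Σ_{i ∈ V} Σ_{j : {i,j} an edge} (ℓ*_ij/ℓ_ij)(f_j′ − f_i′)². -/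
open Finset

/-- The angle at the vertex of a Euclidean triangle whose two adjacent sides have
lengths `a`, `b` and whose opposite side has length `c` (law of cosines). -/
noncomputable def triAngle (a b c : ℝ) : ℝ :=
  Real.arccos ((a ^ 2 + b ^ 2 - c ^ 2) / (2 * a * b))

/-- The dihedral angle `β_{ij,kl}` at the edge `{i,j}` of the tetrahedron `{i,j,k,l}`
with edge lengths `a = ℓ_ij`, `b = ℓ_ik`, `c = ℓ_il`, `p = ℓ_jk`, `q = ℓ_jl`,
`r = ℓ_kl`. -/
noncomputable def dihedralAngle (a b c p q r : ℝ) : ℝ :=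
  Real.arccos ((Real.cos (triAngle b c r)
      - Real.cos (triAngle a b p) * Real.cos (triAngle a c q)) /
    (Real.sin (triAngle a b p) * Real.sin (triAngle a c q)))

/-- The Cayley–Menger determinant of a tetrahedron with edge lengths
`a = ℓ₁₂`, `b = ℓ₁₃`, `c = ℓ₁₄`, `p = ℓ₂₃`, `q = ℓ₂₄`, `r = ℓ₃₄`. -/
noncomputable def cmDet (a b c p q r : ℝ) : ℝ :=
  Matrix.det !![(0 : ℝ), 1, 1, 1, 1;
    1, 0, a ^ 2, b ^ 2, c ^ 2;
    1, a ^ 2, 0, p ^ 2, q ^ 2;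
    1, b ^ 2, p ^ 2, 0, r ^ 2;
    1, c ^ 2, q ^ 2, r ^ 2, 0]

/-- `{i, j}` is an edge of the tetrahedron collection `𝒯`. -/
def IsEdge {V : Type*} [DecidableEq V] (𝒯 : Finset (Finset V)) (i j : V) : Prop :=
  i ≠ j ∧ ∃ T ∈ 𝒯, i ∈ T ∧ j ∈ T

instance {V : Type*} [DecidableEq V] (𝒯 : Finset (Finset V)) (i j : V) :
    Decidable (IsEdge 𝒯 i j) := by
  unfold IsEdge; infer_instance

/-- A three-dimensional conformal structure on an open set `U ⊆ ℝ^V` for a collection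
`𝒯` of tetrahedra: a smooth assignment `f ↦ d f i j` of reals to ordered edges, where
`d f i j` depends only on `f i` and `f j`, the induced lengths `ℓ_ij = d_ij + d_ji` are
positive and make every member of `𝒯` a nondegenerate Euclidean tetrahedron, the metric
condition holds on every triangular face, and `∂ℓ_ij/∂f_i = d_ij`. -/
structure Conformal3D (V : Type*) [Fintype V] [DecidableEq V]
    (𝒯 : Finset (Finset V)) (U : Set (V → ℝ)) where
  d : (V → ℝ) → V → V → ℝ
  openU : IsOpen U
  card4 : ∀ T ∈ 𝒯, T.card = 4
  smooth : ∀ i j, IsEdge 𝒯 i j → ContDiffOn ℝ (⊤ : ℕ∞) (fun f => d f i j) U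
  localDep : ∀ i j, IsEdge 𝒯 i j → ∀ f g : V → ℝ, f i = g i → f j = g j →
    d f i j = d g i j
  lenPos : ∀ f ∈ U, ∀ i j, IsEdge 𝒯 i j → 0 < d f i j + d f j i
  nondeg : ∀ f ∈ U, ∀ T ∈ 𝒯, ∀ i ∈ T, ∀ j ∈ T, ∀ k ∈ T, ∀ l ∈ T,
    i ≠ j → i ≠ k → i ≠ l → j ≠ k → j ≠ l → k ≠ l →
    0 < cmDet (d f i j + d f j i) (d f i k + d f k i) (d f i l + d f l i)
      (d f j k + d f k j) (d f j l + d f l j) (d f k l + d f l k)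
  metricCond : ∀ f ∈ U, ∀ T ∈ 𝒯, ∀ i ∈ T, ∀ j ∈ T, ∀ k ∈ T, i ≠ j → i ≠ k → j ≠ k →
    d f i j ^ 2 + d f j k ^ 2 + d f k i ^ 2 = d f j i ^ 2 + d f k j ^ 2 + d f i k ^ 2
  derivLen : ∀ i j, IsEdge 𝒯 i j → ∀ f ∈ U,
    HasDerivAt (fun s : ℝ =>
        d (Function.update f i s) i j + d (Function.update f i s) j i)
      (d f i j) (f i)

namespace Conformal3D

variable {V : Type*} [Fintype V] [DecidableEq V] {𝒯 : Finset (Finset V)}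
  {U : Set (V → ℝ)}

/-- The length `ℓ_ij = d_ij + d_ji`. -/
noncomputable def len (C : Conformal3D V 𝒯 U) (f : V → ℝ) (i j : V) : ℝ :=
  C.d f i j + C.d f j i

/-- The face angle `γ_{i,jk}` at vertex `i` in the triangle `{i, j, k}`. -/
noncomputable def fang (C : Conformal3D V 𝒯 U) (f : V → ℝ) (i j k : V) : ℝ :=
  triAngle (C.len f i j) (C.len f i k) (C.len f j k)

/-- `h_{ij,k} = (d_ik − d_ij cos γ_{i,jk}) / sin γ_{i,jk}`. -/
noncomputable def hf (C : Conformal3D V 𝒯 U) (f : V → ℝ) (i j k : V) : ℝ :=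
  (C.d f i k - C.d f i j * Real.cos (C.fang f i j k)) / Real.sin (C.fang f i j k)

/-- The dihedral angle `β_{ij,kl}` at edge `{i,j}` in the tetrahedron `{i,j,k,l}`. -/
noncomputable def beta (C : Conformal3D V 𝒯 U) (f : V → ℝ) (i j k l : V) : ℝ :=
  dihedralAngle (C.len f i j) (C.len f i k) (C.len f i l)
    (C.len f j k) (C.len f j l) (C.len f k l)

/-- `h_{ijk,l} = (h_{ij,l} − h_{ij,k} cos β_{ij,kl}) / sin β_{ij,kl}`. -/
noncomputable def ht (C : Conformal3D V 𝒯 U) (f : V → ℝ) (i j k l : V) : ℝ :=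
  (C.hf f i j l - C.hf f i j k * Real.cos (C.beta f i j k l)) /
    Real.sin (C.beta f i j k l)

/-- The dual area `A_{ij,kl} = ½(h_{ij,k} h_{ijk,l} + h_{ij,l} h_{ijl,k})`. -/
noncomputable def Aq (C : Conformal3D V 𝒯 U) (f : V → ℝ) (i j k l : V) : ℝ :=
  (1 / 2) * (C.hf f i j k * C.ht f i j k l + C.hf f i j l * C.ht f i j l k)

/-- The dual length (area) `ℓ*_ij = Σ_{{i,j,k,l} ∈ 𝒯} A_{ij,kl}` (each unordered
tetrahedron containing `{i,j}` counted once; the ordered double sum over `k, l`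
counts it twice, whence `1/2`). -/
noncomputable def dualLen (C : Conformal3D V 𝒯 U) (f : V → ℝ) (i j : V) : ℝ :=
  (1 / 2) * ∑ k : V, ∑ l : V,
    if ({i, j, k, l} : Finset V) ∈ 𝒯 ∧ i ≠ j ∧ i ≠ k ∧ i ≠ l ∧ j ≠ k ∧ j ≠ l ∧ k ≠ l
    then C.Aq f i j k l else 0

/-- The sum `Σ_{{i,j,k,l} ∈ 𝒯} β_{ij,kl}` of dihedral angles around the edge `{i,j}`. -/
noncomputable def angSum (C : Conformal3D V 𝒯 U) (f : V → ℝ) (i j : V) : ℝ :=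
  (1 / 2) * ∑ k : V, ∑ l : V,
    if ({i, j, k, l} : Finset V) ∈ 𝒯 ∧ i ≠ j ∧ i ≠ k ∧ i ≠ l ∧ j ≠ k ∧ j ≠ l ∧ k ≠ l
    then C.beta f i j k l else 0

/-- The edge curvature `K_ij = (2π − Σ_{{i,j,k,l} ∈ 𝒯} β_{ij,kl}) ℓ_ij`. -/
noncomputable def Kedge (C : Conformal3D V 𝒯 U) (f : V → ℝ) (i j : V) : ℝ :=
  (2 * Real.pi - C.angSum f i j) * C.len f i j

/-- The scalar curvature `K_i = Σ_{j : {i,j} edge} (2π − Σ β_{ij,kl}) d_ij`. -/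
noncomputable def Kv (C : Conformal3D V 𝒯 U) (f : V → ℝ) (i : V) : ℝ :=
  ∑ j : V, if IsEdge 𝒯 i j then (2 * Real.pi - C.angSum f i j) * C.d f i j else 0

/-- `q_ij = ∂d_ij/∂f_j`. -/
noncomputable def qq (C : Conformal3D V 𝒯 U) (f : V → ℝ) (i j : V) : ℝ :=
  deriv (fun s : ℝ => C.d (Function.update f j s) i j) (f j)

/-- The Einstein–Hilbert–Regge functional `EHR = Σ_{edges {i,j}} K_ij`
(ordered double sum halved). -/
noncomputable def EHR (C : Conformal3D V 𝒯 U) (f : V → ℝ) : ℝ :=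
  (1 / 2) * ∑ i : V, ∑ j : V, if IsEdge 𝒯 i j then C.Kedge f i j else 0

end Conformal3D

/-- Four times the squared area of the triangle with squared side lengths `x`, `y`, `z`. -/
noncomputable def faceGram (x y z : ℝ) : ℝ := x * y - ((x + y - z) / 2) ^ 2

/-- The inner product of the two face normals along the edge `{i,j}` of a tetrahedron with
squared edge lengths `a = ℓ_ij²`, `b = ℓ_ik²`, `c = ℓ_il²`, `p = ℓ_jk²`, `q = ℓ_jl²`,
`r = ℓ_kl²`. -/
noncomputable def normalGram (a b c p q r : ℝ) : ℝ :=
  a * ((b + c - r) / 2) - ((a + b - p) / 2) * ((a + c - q) / 2)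

/-- The Gram determinant of a tetrahedron, as a function of its squared edge lengths. -/
noncomputable def tetGram (a b c p q r : ℝ) : ℝ :=
  a * b * c + 2 * ((a + b - p) / 2) * ((a + c - q) / 2) * ((b + c - r) / 2)
    - a * ((b + c - r) / 2) ^ 2 - b * ((a + c - q) / 2) ^ 2 - c * ((a + b - p) / 2) ^ 2

/-- The rescaled logarithmic coefficient `h_{ij,k}` of a face: here `u = ℓ_ij d_ij` and
`v = ℓ_ik d_ik`. -/
noncomputable def faceHeight (a b p u v : ℝ) : ℝ := v * a - u * ((a + b - p) / 2)

/-- The coefficient by which the edge `{i,j}` of a tetrahedron contributes to the second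
variation, up to normalization: here `u = ℓ_ij d_ij`, `v = ℓ_ik d_ik` and `w = ℓ_il d_il`. -/
noncomputable def dualCoeff (a b c p q r u v w : ℝ) : ℝ :=
  (2 * faceHeight a b p u v * faceHeight a c q u w
    - normalGram a b c p q r *
      (faceHeight a b p u v ^ 2 / faceGram a b p
        + faceHeight a c q u w ^ 2 / faceGram a c q)) / a ^ 2

/-- The diagonal entry of the Hessian of a tetrahedron in its squared edge lengths. -/
noncomputable def selfCoeff (a b c p q r : ℝ) : ℝ :=
  (-r + (normalGram p a q b r c * b + normalGram b a c p r q * p) / faceGram a b p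
    + (normalGram q a p c r b * c + normalGram c a b q r p * q) / faceGram a c q) / a

/-- The normalized rate of change of the dihedral angle at `{i,j}` when half the squared edge
lengths change at rates `a'`, …, `r'`. -/
noncomputable def dihedralRate (a b c p q r a' b' c' p' q' r' : ℝ) : ℝ :=
  a * r' - r * a'
    + (normalGram p a q b r c * (b * a' - a * b')
        + normalGram b a c p r q * (p * a' - a * p')) / faceGram a b p
    + (normalGram q a p c r b * (c * a' - a * c')
        + normalGram c a b q r p * (q * a' - a * q')) / faceGram a c q

theorem faceGram_relabel (x y z : ℝ) :
    faceGram y x z = faceGram x y z ∧ faceGram x z y = faceGram x y z ∧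
      faceGram z x y = faceGram x y z ∧ faceGram y z x = faceGram x y z ∧
      faceGram z y x = faceGram x y z := by
  unfold faceGram
  refine ⟨?_, ?_, ?_, ?_, ?_⟩ <;> ring

theorem normalGram_relabel (a b c p q r : ℝ) :
    normalGram a p q b c r = normalGram a b c p q r ∧
      normalGram a c b q p r = normalGram a b c p q r ∧
      normalGram a q p c b r = normalGram a b c p q r := by
  unfold normalGram
  refine ⟨?_, ?_, ?_⟩ <;> ring

theorem cmDet_eq (a b c p q r : ℝ) :
    cmDet a b c p q r = 8 * tetGram (a ^ 2) (b ^ 2) (c ^ 2) (p ^ 2) (q ^ 2) (r ^ 2) := by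
  unfold cmDet tetGram
  simp [Matrix.det_succ_row_zero, Fin.sum_univ_succ, Fin.succAbove]
  ring

theorem faceGram_mul_faceGram (a b c p q r : ℝ) :
    faceGram a b p * faceGram a c q
      = normalGram a b c p q r ^ 2 + a * tetGram a b c p q r := by
  unfold faceGram normalGram tetGram; ring

theorem dualCoeff_eq (a b c p q r u v w u' v' w' : ℝ) (ha : a ≠ 0)
    (hk : faceGram a b p ≠ 0) (hl : faceGram a c q ≠ 0) (hu : u' = a - u)
    (hv : v' = v - u + (p + a - b) / 2) (hw : w' = w - u + (q + a - c) / 2) :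
    dualCoeff a b c p q r u v w
      = selfCoeff a b c p q r * (u * u')
        - (normalGram b a c p r q * (u * v') + normalGram p a q b r c * (v * u')
            + normalGram a b c p q r * (v * v')) / faceGram a b p
        - (normalGram c a b q r p * (u * w') + normalGram q a p c r b * (w * u')
            + normalGram a b c p q r * (w * w')) / faceGram a c q
        + v * w' + w * v' := by
  subst hu hv hw
  unfold dualCoeff selfCoeff
  field_simp
  unfold faceHeight faceGram normalGram
  ring

theorem dihedralRate_eq (a b c p q r a' b' c' p' q' r' : ℝ)
    (hk : faceGram a b p ≠ 0) (hl : faceGram a c q ≠ 0) :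
    dihedralRate a b c p q r a' b' c' p' q' r'
      = -(a' * (b + c - r) + a * (b' + c' - r')
          - (a' + b' - p') * ((a + c - q) / 2) - ((a + b - p) / 2) * (a' + c' - q'))
        + normalGram a b c p q r *
          ((a' * b + a * b' - ((a + b - p) / 2) * (a' + b' - p')) / faceGram a b p
          + (a' * c + a * c' - ((a + c - q) / 2) * (a' + c' - q')) / faceGram a c q) := by
  unfold dihedralRate
  field_simp
  unfold faceGram normalGram
  ring

theorem dihedralRate_div (a b c p q r a' b' c' p' q' r' : ℝ) (ha : a ≠ 0) :
    dihedralRate a b c p q r a' b' c' p' q' r' / a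
      = selfCoeff a b c p q r * a' + r'
        - (normalGram p a q b r c * b' + normalGram b a c p r q * p') / faceGram a b p
        - (normalGram q a p c r b * c' + normalGram c a b q r p * q') / faceGram a c q := by
  unfold dihedralRate selfCoeff
  field_simp
  ring

theorem selfCoeff_mul (a b c p q r : ℝ) (ha : a ≠ 0) :
    selfCoeff a b c p q r * a
      = -r + (normalGram p a q b r c * b + normalGram b a c p r q * p) / faceGram a b p
        + (normalGram q a p c r b * c + normalGram c a b q r p * q) / faceGram a c q := by
  unfold selfCoeff
  field_simp

/-- Schläfli's formula for one tetrahedron. -/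
theorem sum_dihedralRate (a b c p q r a' b' c' p' q' r' : ℝ) :
    dihedralRate a b c p q r a' b' c' p' q' r' + dihedralRate b a c p r q b' a' c' p' r' q'
      + dihedralRate c a b q r p c' a' b' q' r' p' + dihedralRate p a q b r c p' a' q' b' r' c'
      + dihedralRate q a p c r b q' a' p' c' r' b'
      + dihedralRate r b p c q a r' b' p' c' q' a' = 0 := by
  unfold dihedralRate
  simp only [normalGram_relabel a b c p q r, normalGram_relabel b a c p r q,
    normalGram_relabel c a b q r p, normalGram_relabel p a q b r c,
    normalGram_relabel q a p c r b, normalGram_relabel r b p c q a,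
    faceGram_relabel a b p, faceGram_relabel a c q, faceGram_relabel b c r,
    faceGram_relabel p q r]
  ring

/-- The second variation of one tetrahedron. -/
theorem sum_dihedralRate_mul (a b c p q r xi xj xk xl pij pji pik pki pil pli pjk pkj pjl plj
    pkl plk : ℝ) (ha : a ≠ 0) (hb : b ≠ 0) (hc : c ≠ 0) (hp : p ≠ 0) (hq : q ≠ 0) (hr : r ≠ 0)
    (hF₁ : faceGram a b p ≠ 0) (hF₂ : faceGram a c q ≠ 0) (hF₃ : faceGram b c r ≠ 0)
    (hF₄ : faceGram p q r ≠ 0)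
    (hij : pij + pji = a) (hik : pik + pki = b) (hil : pil + pli = c) (hjk : pjk + pkj = p)
    (hjl : pjl + plj = q) (hkl : pkl + plk = r)
    (hijk : pij + pjk + pki = pji + pkj + pik) (hijl : pij + pjl + pli = pji + plj + pil)
    (hikl : pik + pkl + pli = pki + plk + pil) {a' b' c' p' q' r' : ℝ}
    (ha' : a' = pij * xi + pji * xj) (hb' : b' = pik * xi + pki * xk)
    (hc' : c' = pil * xi + pli * xl) (hp' : p' = pjk * xj + pkj * xk)
    (hq' : q' = pjl * xj + plj * xl) (hr' : r' = pkl * xk + plk * xl) :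
    dihedralRate a b c p q r a' b' c' p' q' r' / a * a'
      + dihedralRate b a c p r q b' a' c' p' r' q' / b * b'
      + dihedralRate c a b q r p c' a' b' q' r' p' / c * c'
      + dihedralRate p a q b r c p' a' q' b' r' c' / p * p'
      + dihedralRate q a p c r b q' a' p' c' r' b' / q * q'
      + dihedralRate r b p c q a r' b' p' c' q' a' / r * r'
      = -(dualCoeff a b c p q r pij pik pil * (xi - xj) ^ 2
        + dualCoeff b a c p r q pik pij pil * (xi - xk) ^ 2
        + dualCoeff c a b q r p pil pij pik * (xi - xl) ^ 2
        + dualCoeff p a q b r c pjk pji pjl * (xj - xk) ^ 2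
        + dualCoeff q a p c r b pjl pji pjk * (xj - xl) ^ 2
        + dualCoeff r b p c q a pkl pki pkj * (xk - xl) ^ 2) := by
  have F₁ := faceGram_relabel a b p
  have F₂ := faceGram_relabel a c q
  have F₃ := faceGram_relabel b c r
  have F₄ := faceGram_relabel p q r
  rw [dualCoeff_eq a b c p q r pij pik pil pji pjk pjl ha hF₁ hF₂ (by linarith) (by linarith)
      (by linarith),
    dualCoeff_eq b a c p r q pik pij pil pki pkj pkl hb (by simpa only [F₁]) hF₃
      (by linarith) (by linarith) (by linarith),
    dualCoeff_eq c a b q r p pil pij pik pli plj plk hc (by simpa only [F₂])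
      (by simpa only [F₃]) (by linarith) (by linarith) (by linarith),
    dualCoeff_eq p a q b r c pjk pji pjl pkj pki pkl hp (by simpa only [F₁])
      hF₄ (by linarith) (by linarith) (by linarith),
    dualCoeff_eq q a p c r b pjl pji pjk plj pli plk hq (by simpa only [F₂])
      (by simpa only [F₄]) (by linarith) (by linarith) (by linarith),
    dualCoeff_eq r b p c q a pkl pki pkj plk pli plj hr (by simpa only [F₃])
      (by simpa only [F₄]) (by linarith) (by linarith) (by linarith)]
  rw [dihedralRate_div _ _ _ _ _ _ _ _ _ _ _ _ ha, dihedralRate_div _ _ _ _ _ _ _ _ _ _ _ _ hb,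
    dihedralRate_div _ _ _ _ _ _ _ _ _ _ _ _ hc, dihedralRate_div _ _ _ _ _ _ _ _ _ _ _ _ hp,
    dihedralRate_div _ _ _ _ _ _ _ _ _ _ _ _ hq, dihedralRate_div _ _ _ _ _ _ _ _ _ _ _ _ hr]
  have s₁ := selfCoeff_mul a b c p q r ha
  have s₂ := selfCoeff_mul b a c p r q hb
  have s₃ := selfCoeff_mul c a b q r p hc
  have s₄ := selfCoeff_mul p a q b r c hp
  have s₅ := selfCoeff_mul q a p c r b hq
  have s₆ := selfCoeff_mul r b p c q a hr
  simp only [normalGram_relabel a b c p q r, normalGram_relabel b a c p r q,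
    normalGram_relabel c a b q r p, normalGram_relabel p a q b r c,
    normalGram_relabel q a p c r b, normalGram_relabel r b p c q a,
    F₁, F₂, F₃,
    F₄] at s₁ s₂ s₃ s₄ s₅ s₆ ⊢
  generalize selfCoeff a b c p q r = t₁ at *
  generalize selfCoeff b a c p r q = t₂ at *
  generalize selfCoeff c a b q r p = t₃ at *
  generalize selfCoeff p a q b r c = t₄ at *
  generalize selfCoeff q a p c r b = t₅ at *
  generalize selfCoeff r b p c q a = t₆ at *
  simp only [div_eq_mul_inv] at *
  subst ha' hb' hc' hp' hq' hr' hij hik hil hjk hjl hkl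
  linear_combination s₁ * (pij * xi ^ 2 + pji * xj ^ 2) + s₂ * (pik * xi ^ 2 + pki * xk ^ 2)
    + s₃ * (pil * xi ^ 2 + pli * xl ^ 2) + s₄ * (pjk * xj ^ 2 + pkj * xk ^ 2)
    + s₅ * (pjl * xj ^ 2 + plj * xl ^ 2) + s₆ * (pkl * xk ^ 2 + plk * xl ^ 2)

theorem cos_triAngle {a b c : ℝ} (ha : 0 < a) (hb : 0 < b)
    (h : 0 < faceGram (a ^ 2) (b ^ 2) (c ^ 2)) :
    Real.cos (triAngle a b c) = (a ^ 2 + b ^ 2 - c ^ 2) / (2 * a * b) := by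
  have hab : 0 < 2 * a * b := by positivity
  have hlt : |a ^ 2 + b ^ 2 - c ^ 2| < 2 * a * b := by
    apply abs_lt_of_sq_lt_sq _ hab.le
    unfold faceGram at h
    linarith
  obtain ⟨h₁, h₂⟩ := abs_lt.mp hlt
  apply Real.cos_arccos
  · rw [le_div_iff₀ hab]; linarith
  · rw [div_le_iff₀ hab]; linarith

theorem sin_triAngle {a b c : ℝ} (ha : 0 < a) (hb : 0 < b) :
    Real.sin (triAngle a b c) = √(faceGram (a ^ 2) (b ^ 2) (c ^ 2)) / (a * b) := by
  unfold triAngle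
  rw [Real.sin_arccos, ← Real.sqrt_sq (mul_pos ha hb).le, ← Real.sqrt_div' _ (by positivity)]
  congr 1
  unfold faceGram
  field_simp

theorem sin_triAngle_of_nonpos {a b c : ℝ} (ha : 0 < a) (hb : 0 < b)
    (h : faceGram (a ^ 2) (b ^ 2) (c ^ 2) ≤ 0) : Real.sin (triAngle a b c) = 0 := by
  rw [sin_triAngle ha hb, Real.sqrt_eq_zero_of_nonpos h, zero_div]

/-- The edge lengths of a tetrahedron whose Gram determinant is positive; its faces need not
satisfy the triangle inequality. -/
structure IsGramPos (a b c p q r : ℝ) : Prop where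
  ha : 0 < a
  hb : 0 < b
  hc : 0 < c
  hp : 0 < p
  hq : 0 < q
  hr : 0 < r
  gram : 0 < tetGram (a ^ 2) (b ^ 2) (c ^ 2) (p ^ 2) (q ^ 2) (r ^ 2)

namespace IsGramPos

variable {a b c p q r : ℝ}

theorem swap_jk (h : IsGramPos a b c p q r) : IsGramPos b a c p r q where
  ha := h.hb
  hb := h.ha
  hc := h.hc
  hp := h.hp
  hq := h.hr
  hr := h.hq
  gram := h.gram.trans_eq (by unfold tetGram; ring)

theorem swap_kl (h : IsGramPos a b c p q r) : IsGramPos a c b q p r where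
  ha := h.ha
  hb := h.hc
  hc := h.hb
  hp := h.hq
  hq := h.hp
  hr := h.hr
  gram := h.gram.trans_eq (by unfold tetGram; ring)

theorem swap_ij (h : IsGramPos a b c p q r) : IsGramPos a p q b c r where
  ha := h.ha
  hb := h.hp
  hc := h.hq
  hp := h.hb
  hq := h.hc
  hr := h.hr
  gram := h.gram.trans_eq (by unfold tetGram; ring)

theorem faceGram_mul_pos (h : IsGramPos a b c p q r) :
    0 < faceGram (a ^ 2) (b ^ 2) (p ^ 2) * faceGram (a ^ 2) (c ^ 2) (q ^ 2) := by
  rw [faceGram_mul_faceGram _ _ _ _ _ (r ^ 2)]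
  have := mul_pos (pow_pos h.ha 2) h.gram
  positivity

theorem faceGram_pos_iff_left (h : IsGramPos a b c p q r) :
    0 < faceGram (a ^ 2) (c ^ 2) (q ^ 2) ↔ 0 < faceGram (a ^ 2) (b ^ 2) (p ^ 2) :=
  ⟨fun h' => pos_of_mul_pos_left h.faceGram_mul_pos h'.le,
    fun h' => pos_of_mul_pos_right h.faceGram_mul_pos h'.le⟩

theorem faceGram_pos_iff_right (h : IsGramPos a b c p q r) :
    0 < faceGram (b ^ 2) (c ^ 2) (r ^ 2) ↔ 0 < faceGram (a ^ 2) (b ^ 2) (p ^ 2) := by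
  rw [h.swap_jk.faceGram_pos_iff_left, (faceGram_relabel (a ^ 2) (b ^ 2) (p ^ 2)).1]

theorem faceGram_pos_iff_opp (h : IsGramPos a b c p q r) :
    0 < faceGram (p ^ 2) (q ^ 2) (r ^ 2) ↔ 0 < faceGram (a ^ 2) (b ^ 2) (p ^ 2) := by
  rw [h.swap_ij.faceGram_pos_iff_right, (faceGram_relabel (a ^ 2) (b ^ 2) (p ^ 2)).2.1]

theorem dihedralAngle_eq (h : IsGramPos a b c p q r)
    (hF : 0 < faceGram (a ^ 2) (b ^ 2) (p ^ 2)) :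
    dihedralAngle a b c p q r
      = Real.arccos (normalGram (a ^ 2) (b ^ 2) (c ^ 2) (p ^ 2) (q ^ 2) (r ^ 2) /
          √(faceGram (a ^ 2) (b ^ 2) (p ^ 2) * faceGram (a ^ 2) (c ^ 2) (q ^ 2))) := by
  have hG := h.faceGram_pos_iff_left.mpr hF
  have := h.ha
  have := h.hb
  have := h.hc
  have := Real.sqrt_pos.mpr hF
  have := Real.sqrt_pos.mpr hG
  unfold dihedralAngle
  rw [cos_triAngle h.hb h.hc (h.faceGram_pos_iff_right.mpr hF), cos_triAngle h.ha h.hb hF,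
    cos_triAngle h.ha h.hc hG, sin_triAngle h.ha h.hb, sin_triAngle h.ha h.hc,
    Real.sqrt_mul hF.le]
  congr 1
  unfold normalGram
  field_simp

theorem dihedralAngle_of_not_pos (h : IsGramPos a b c p q r)
    (hF : ¬ 0 < faceGram (a ^ 2) (b ^ 2) (p ^ 2)) :
    dihedralAngle a b c p q r = Real.arccos 0 := by
  unfold dihedralAngle
  rw [sin_triAngle_of_nonpos h.ha h.hb (not_lt.mp hF), zero_mul, div_zero]

theorem sq_cos_le_one (h : IsGramPos a b c p q r) :
    (normalGram (a ^ 2) (b ^ 2) (c ^ 2) (p ^ 2) (q ^ 2) (r ^ 2) /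
          √(faceGram (a ^ 2) (b ^ 2) (p ^ 2) * faceGram (a ^ 2) (c ^ 2) (q ^ 2))) ^ 2 ≤ 1 := by
  rw [div_pow, Real.sq_sqrt h.faceGram_mul_pos.le, div_le_one h.faceGram_mul_pos,
    faceGram_mul_faceGram _ _ _ _ _ (r ^ 2)]
  have := mul_pos (pow_pos h.ha 2) h.gram
  linarith

theorem cos_dihedralAngle (h : IsGramPos a b c p q r)
    (hF : 0 < faceGram (a ^ 2) (b ^ 2) (p ^ 2)) :
    Real.cos (dihedralAngle a b c p q r)
      = normalGram (a ^ 2) (b ^ 2) (c ^ 2) (p ^ 2) (q ^ 2) (r ^ 2) /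
          (√(faceGram (a ^ 2) (b ^ 2) (p ^ 2)) * √(faceGram (a ^ 2) (c ^ 2) (q ^ 2))) := by
  have := abs_le.mp ((sq_le_one_iff_abs_le_one _).mp h.sq_cos_le_one)
  rw [h.dihedralAngle_eq hF, Real.cos_arccos this.1 this.2, Real.sqrt_mul hF.le]

theorem sin_dihedralAngle (h : IsGramPos a b c p q r)
    (hF : 0 < faceGram (a ^ 2) (b ^ 2) (p ^ 2)) :
    Real.sin (dihedralAngle a b c p q r)
      = a * √(tetGram (a ^ 2) (b ^ 2) (c ^ 2) (p ^ 2) (q ^ 2) (r ^ 2)) /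
          (√(faceGram (a ^ 2) (b ^ 2) (p ^ 2)) * √(faceGram (a ^ 2) (c ^ 2) (q ^ 2))) := by
  have hM := h.faceGram_mul_pos
  rw [h.dihedralAngle_eq hF, Real.sin_arccos, div_pow, Real.sq_sqrt hM.le,
    one_sub_div hM.ne', Real.sqrt_div' _ hM.le, Real.sqrt_mul hF.le]
  congr 1
  rw [faceGram_mul_faceGram _ _ _ _ _ (r ^ 2), add_sub_cancel_left,
    Real.sqrt_mul (sq_nonneg a), Real.sqrt_sq h.ha.le]

end IsGramPos

theorem hasDerivAt_arccos_div_sqrt {N D E : ℝ → ℝ} {N' D' E' M t : ℝ}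
    (hN : HasDerivAt N N' t) (hD : HasDerivAt D D' t) (hE : HasDerivAt E E' t)
    (hD₀ : 0 < D t) (hE₀ : 0 < E t) (hM : 0 < M) (h : D t * E t = N t ^ 2 + M) :
    HasDerivAt (fun s => Real.arccos (N s / √(D s * E s)))
      ((-N' + N t / 2 * (D' / D t + E' / E t)) / √M) t := by
  have hDE : 0 < D t * E t := mul_pos hD₀ hE₀
  have hs := Real.sqrt_pos.mpr hDE
  have hsM := Real.sqrt_pos.mpr hM
  have hsq : (N t / √(D t * E t)) ^ 2 = 1 - M / (D t * E t) := by
    rw [div_pow, Real.sq_sqrt hDE.le, eq_sub_iff_add_eq, ← add_div, ← h, div_self hDE.ne']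
  have hne : 0 < M / (D t * E t) := div_pos hM hDE
  have hF := hN.div ((hD.mul hE).sqrt hDE.ne') hs.ne'
  have hA := (Real.hasDerivAt_arccos (x := N t / √(D t * E t)) (by
    intro hc; rw [hc] at hsq; linarith) (by intro hc; rw [hc] at hsq; linarith)).comp t hF
  refine hA.congr_deriv ?_
  rw [hsq, sub_sub_cancel, Real.sqrt_div hM.le]
  have hs2 : √(D t * E t) ^ 2 = D t * E t := Real.sq_sqrt hDE.le
  simp only [Pi.mul_apply]
  field_simp
  rw [hs2]
  field_simp
  ring

/-- The rate of change of a dihedral angle in terms of the rates of change of the lengths. -/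
noncomputable def dihedralSpeed (a b c p q r a' b' c' p' q' r' : ℝ) : ℝ :=
  if 0 < faceGram (a ^ 2) (b ^ 2) (p ^ 2) then
    dihedralRate (a ^ 2) (b ^ 2) (c ^ 2) (p ^ 2) (q ^ 2) (r ^ 2)
      (a * a') (b * b') (c * c') (p * p') (q * q') (r * r')
        / (a * √(tetGram (a ^ 2) (b ^ 2) (c ^ 2) (p ^ 2) (q ^ 2) (r ^ 2)))
  else 0

theorem hasDerivAt_dihedralAngle {a b c p q r : ℝ → ℝ} {a' b' c' p' q' r' t : ℝ}
    (ha : HasDerivAt a a' t) (hb : HasDerivAt b b' t) (hc : HasDerivAt c c' t)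
    (hp : HasDerivAt p p' t) (hq : HasDerivAt q q' t) (hr : HasDerivAt r r' t)
    (h : ∀ᶠ s in nhds t, IsGramPos (a s) (b s) (c s) (p s) (q s) (r s)) :
    HasDerivAt (fun s => dihedralAngle (a s) (b s) (c s) (p s) (q s) (r s))
      (dihedralSpeed (a t) (b t) (c t) (p t) (q t) (r t) a' b' c' p' q' r') t := by
  have h₀ := h.self_of_nhds
  have face : ∀ {x y z : ℝ → ℝ} {x' y' z' : ℝ}, HasDerivAt x x' t → HasDerivAt y y' t →
      HasDerivAt z z' t → HasDerivAt (fun s => faceGram (x s ^ 2) (y s ^ 2) (z s ^ 2))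
        (2 * (x t * x' * y t ^ 2 + x t ^ 2 * (y t * y')
          - (x t ^ 2 + y t ^ 2 - z t ^ 2) / 2 * (x t * x' + y t * y' - z t * z'))) t := by
    intro x y z x' y' z' hx hy hz
    unfold faceGram
    refine (((hx.pow 2).mul (hy.pow 2)).sub
      (((((hx.pow 2).add (hy.pow 2)).sub (hz.pow 2)).div_const 2).pow 2)).congr_deriv ?_
    simp only [Pi.pow_apply, Pi.add_apply, Pi.sub_apply]
    ring
  have hcont := (face ha hb hp).continuousAt
  unfold dihedralSpeed
  split_ifs with hF
  · have hF' := hcont.eventually (lt_mem_nhds hF)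
    have heq : (fun s => dihedralAngle (a s) (b s) (c s) (p s) (q s) (r s)) =ᶠ[nhds t] _ :=
      (h.and hF').mono fun s hs => hs.1.dihedralAngle_eq hs.2
    refine HasDerivAt.congr_of_eventuallyEq ?_ heq
    have hG := h₀.faceGram_pos_iff_left.mpr hF
    have hN : HasDerivAt (fun s => normalGram (a s ^ 2) (b s ^ 2) (c s ^ 2) (p s ^ 2) (q s ^ 2)
        (r s ^ 2)) (a t * a' * (b t ^ 2 + c t ^ 2 - r t ^ 2)
          + a t ^ 2 * (b t * b' + c t * c' - r t * r')
          - (a t * a' + b t * b' - p t * p') * ((a t ^ 2 + c t ^ 2 - q t ^ 2) / 2)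
          - ((a t ^ 2 + b t ^ 2 - p t ^ 2) / 2) * (a t * a' + c t * c' - q t * q')) t := by
      unfold normalGram
      refine (((ha.pow 2).mul ((((hb.pow 2).add (hc.pow 2)).sub (hr.pow 2)).div_const 2)).sub
        (((((ha.pow 2).add (hb.pow 2)).sub (hp.pow 2)).div_const 2).mul
          ((((ha.pow 2).add (hc.pow 2)).sub (hq.pow 2)).div_const 2))).congr_deriv ?_
      simp only [Pi.pow_apply, Pi.add_apply, Pi.sub_apply]
      ring
    refine (hasDerivAt_arccos_div_sqrt hN (face ha hb hp) (face ha hc hq) hF hG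
      (mul_pos (pow_pos h₀.ha 2) h₀.gram) (faceGram_mul_faceGram _ _ _ _ _ _)).congr_deriv ?_
    rw [dihedralRate_eq _ _ _ _ _ _ _ _ _ _ _ _ hF.ne' hG.ne', Real.sqrt_mul (sq_nonneg _),
      Real.sqrt_sq h₀.ha.le]
    ring
  · have hne : faceGram (a t ^ 2) (b t ^ 2) (p t ^ 2) < 0 :=
      lt_of_le_of_ne (not_lt.mp hF) (left_ne_zero_of_mul h₀.faceGram_mul_pos.ne')
    have hF' := hcont.eventually (gt_mem_nhds hne)
    exact (hasDerivAt_const t (Real.arccos 0)).congr_of_eventuallyEq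
      ((h.and hF').mono fun s hs => hs.1.dihedralAngle_of_not_pos hs.2.not_gt)

theorem tetGram_relabel (a b c p q r : ℝ) :
    tetGram b a c p r q = tetGram a b c p q r ∧ tetGram c a b q r p = tetGram a b c p q r ∧
      tetGram p a q b r c = tetGram a b c p q r ∧ tetGram q a p c r b = tetGram a b c p q r ∧
      tetGram r b p c q a = tetGram a b c p q r ∧ tetGram a p q b c r = tetGram a b c p q r ∧
      tetGram a c b q p r = tetGram a b c p q r := by
  unfold tetGram
  refine ⟨?_, ?_, ?_, ?_, ?_, ?_, ?_⟩ <;> ring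

/-- Twice the dual area of the edge `{i,j}` divided by its length, where `u = d_ij`,
`v = d_ik` and `w = d_il`. -/
noncomputable def dualRatio (a b c p q r u v w : ℝ) : ℝ :=
  if 0 < faceGram (a ^ 2) (b ^ 2) (p ^ 2) then
    dualCoeff (a ^ 2) (b ^ 2) (c ^ 2) (p ^ 2) (q ^ 2) (r ^ 2) (a * u) (b * v) (c * w)
      / √(tetGram (a ^ 2) (b ^ 2) (c ^ 2) (p ^ 2) (q ^ 2) (r ^ 2))
  else 0

theorem dihedralSpeed_swap_ends (a b c p q r a' b' c' p' q' r' : ℝ) :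
    dihedralSpeed a p q b c r a' p' q' b' c' r'
      = dihedralSpeed a b c p q r a' b' c' p' q' r' := by
  unfold dihedralSpeed dihedralRate
  simp only [faceGram_relabel (a ^ 2) (b ^ 2) (p ^ 2), faceGram_relabel (a ^ 2) (c ^ 2) (q ^ 2),
    tetGram_relabel (a ^ 2) (b ^ 2) (c ^ 2) (p ^ 2) (q ^ 2) (r ^ 2)]
  split_ifs
  · ring
  · rfl

theorem dualRatio_swap_ends {a b c p q r dij dji dik dki dil dli djk dkj djl dlj : ℝ}
    (hij : dij + dji = a) (hik : dik + dki = b) (hil : dil + dli = c) (hjk : djk + dkj = p)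
    (hjl : djl + dlj = q)
    (hijk : dij ^ 2 + djk ^ 2 + dki ^ 2 = dji ^ 2 + dkj ^ 2 + dik ^ 2)
    (hijl : dij ^ 2 + djl ^ 2 + dli ^ 2 = dji ^ 2 + dlj ^ 2 + dil ^ 2) :
    dualRatio a p q b c r dji djk djl = dualRatio a b c p q r dij dik dil := by
  have e₁ : faceHeight (a ^ 2) (p ^ 2) (b ^ 2) (a * dji) (p * djk)
      = faceHeight (a ^ 2) (b ^ 2) (p ^ 2) (a * dij) (b * dik) := by
    unfold faceHeight
    subst hij hik hjk
    linear_combination (dij + dji) ^ 2 * hijk / 2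
  have e₂ : faceHeight (a ^ 2) (q ^ 2) (c ^ 2) (a * dji) (q * djl)
      = faceHeight (a ^ 2) (c ^ 2) (q ^ 2) (a * dij) (c * dil) := by
    unfold faceHeight
    subst hij hil hjl
    linear_combination (dij + dji) ^ 2 * hijl / 2
  unfold dualRatio dualCoeff
  rw [e₁, e₂, (normalGram_relabel (a ^ 2) (b ^ 2) (c ^ 2) (p ^ 2) (q ^ 2) (r ^ 2)).1]
  simp only [faceGram_relabel (a ^ 2) (b ^ 2) (p ^ 2), faceGram_relabel (a ^ 2) (c ^ 2) (q ^ 2),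
    tetGram_relabel (a ^ 2) (b ^ 2) (c ^ 2) (p ^ 2) (q ^ 2) (r ^ 2)]

namespace IsGramPos

variable {a b c p q r : ℝ}

theorem sum_dihedralSpeed (h : IsGramPos a b c p q r) (a' b' c' p' q' r' : ℝ) :
    a * dihedralSpeed a b c p q r a' b' c' p' q' r'
      + b * dihedralSpeed b a c p r q b' a' c' p' r' q'
      + c * dihedralSpeed c a b q r p c' a' b' q' r' p'
      + p * dihedralSpeed p a q b r c p' a' q' b' r' c'
      + q * dihedralSpeed q a p c r b q' a' p' c' r' b'
      + r * dihedralSpeed r b p c q a r' b' p' c' q' a' = 0 := by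
  have := h.ha
  have := h.hb
  have := h.hc
  have := h.hp
  have := h.hq
  have := h.hr
  have := Real.sqrt_pos.mpr h.gram
  unfold dihedralSpeed
  simp only [faceGram_relabel (a ^ 2) (b ^ 2) (p ^ 2), faceGram_relabel (a ^ 2) (c ^ 2) (q ^ 2),
    faceGram_relabel (b ^ 2) (c ^ 2) (r ^ 2), h.faceGram_pos_iff_left, h.faceGram_pos_iff_right,
    tetGram_relabel (a ^ 2) (b ^ 2) (c ^ 2) (p ^ 2) (q ^ 2) (r ^ 2)]
  split_ifs
  · have key := sum_dihedralRate (a ^ 2) (b ^ 2) (c ^ 2) (p ^ 2) (q ^ 2) (r ^ 2)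
      (a * a') (b * b') (c * c') (p * p') (q * q') (r * r')
    field_simp
    linear_combination key
  · simp

theorem sum_dihedralSpeed_mul (h : IsGramPos a b c p q r)
    {xi xj xk xl dij dji dik dki dil dli djk dkj djl dlj dkl dlk a' b' c' p' q' r' : ℝ}
    (hij : dij + dji = a) (hik : dik + dki = b) (hil : dil + dli = c) (hjk : djk + dkj = p)
    (hjl : djl + dlj = q) (hkl : dkl + dlk = r)
    (hijk : dij ^ 2 + djk ^ 2 + dki ^ 2 = dji ^ 2 + dkj ^ 2 + dik ^ 2)
    (hijl : dij ^ 2 + djl ^ 2 + dli ^ 2 = dji ^ 2 + dlj ^ 2 + dil ^ 2)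
    (hikl : dik ^ 2 + dkl ^ 2 + dli ^ 2 = dki ^ 2 + dlk ^ 2 + dil ^ 2)
    (ha' : a' = dij * xi + dji * xj) (hb' : b' = dik * xi + dki * xk)
    (hc' : c' = dil * xi + dli * xl) (hp' : p' = djk * xj + dkj * xk)
    (hq' : q' = djl * xj + dlj * xl) (hr' : r' = dkl * xk + dlk * xl) :
    dihedralSpeed a b c p q r a' b' c' p' q' r' * a'
      + dihedralSpeed b a c p r q b' a' c' p' r' q' * b'
      + dihedralSpeed c a b q r p c' a' b' q' r' p' * c'
      + dihedralSpeed p a q b r c p' a' q' b' r' c' * p'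
      + dihedralSpeed q a p c r b q' a' p' c' r' b' * q'
      + dihedralSpeed r b p c q a r' b' p' c' q' a' * r'
      = -(dualRatio a b c p q r dij dik dil * (xi - xj) ^ 2
        + dualRatio b a c p r q dik dij dil * (xi - xk) ^ 2
        + dualRatio c a b q r p dil dij dik * (xi - xl) ^ 2
        + dualRatio p a q b r c djk dji djl * (xj - xk) ^ 2
        + dualRatio q a p c r b djl dji djk * (xj - xl) ^ 2
        + dualRatio r b p c q a dkl dki dkj * (xk - xl) ^ 2) := by
  have ha := h.ha
  have hb := h.hb
  have hc := h.hc
  have hp := h.hp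
  have hq := h.hq
  have hr := h.hr
  have hW := Real.sqrt_pos.mpr h.gram
  unfold dihedralSpeed dualRatio
  simp only [faceGram_relabel (a ^ 2) (b ^ 2) (p ^ 2), faceGram_relabel (a ^ 2) (c ^ 2) (q ^ 2),
    faceGram_relabel (b ^ 2) (c ^ 2) (r ^ 2), h.faceGram_pos_iff_left, h.faceGram_pos_iff_right,
    tetGram_relabel (a ^ 2) (b ^ 2) (c ^ 2) (p ^ 2) (q ^ 2) (r ^ 2)]
  split_ifs with hF
  · have key := sum_dihedralRate_mul (a ^ 2) (b ^ 2) (c ^ 2) (p ^ 2) (q ^ 2) (r ^ 2) xi xj xk xl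
      (a * dij) (a * dji) (b * dik) (b * dki) (c * dil) (c * dli) (p * djk) (p * dkj)
      (q * djl) (q * dlj) (r * dkl) (r * dlk) (by positivity) (by positivity) (by positivity)
      (by positivity) (by positivity) (by positivity) hF.ne'
      (h.faceGram_pos_iff_left.mpr hF).ne' (h.faceGram_pos_iff_right.mpr hF).ne'
      (h.faceGram_pos_iff_opp.mpr hF).ne'
      (by rw [← hij]; ring) (by rw [← hik]; ring) (by rw [← hil]; ring) (by rw [← hjk]; ring)
      (by rw [← hjl]; ring) (by rw [← hkl]; ring)
      (by rw [← hij, ← hik, ← hjk]; linear_combination hijk)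
      (by rw [← hij, ← hil, ← hjl]; linear_combination hijl)
      (by rw [← hik, ← hil, ← hkl]; linear_combination hikl)
      (a' := a * a') (b' := b * b') (c' := c * c') (p' := p * p') (q' := q * q') (r' := r * r')
      (by rw [ha']; ring) (by rw [hb']; ring) (by rw [hc']; ring) (by rw [hp']; ring)
      (by rw [hq']; ring) (by rw [hr']; ring)
    have split : ∀ R z z' : ℝ, 0 < z →
        R / (z * √(tetGram (a ^ 2) (b ^ 2) (c ^ 2) (p ^ 2) (q ^ 2) (r ^ 2))) * z'
          = R / z ^ 2 * (z * z') / √(tetGram (a ^ 2) (b ^ 2) (c ^ 2) (p ^ 2) (q ^ 2) (r ^ 2)) := by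
      intro R z z' hz
      field_simp
    rw [split _ a _ ha, split _ b _ hb, split _ c _ hc, split _ p _ hp, split _ q _ hq,
      split _ r _ hr]
    linear_combination key / √(tetGram (a ^ 2) (b ^ 2) (c ^ 2) (p ^ 2) (q ^ 2) (r ^ 2))
  · simp

theorem height_eq (h : IsGramPos a b c p q r) (hF : 0 < faceGram (a ^ 2) (b ^ 2) (p ^ 2))
    (u v : ℝ) :
    (v - u * Real.cos (triAngle a b p)) / Real.sin (triAngle a b p)
      = faceHeight (a ^ 2) (b ^ 2) (p ^ 2) (a * u) (b * v)
        / (a * √(faceGram (a ^ 2) (b ^ 2) (p ^ 2))) := by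
  have ha := h.ha
  have hb := h.hb
  have hs := Real.sqrt_pos.mpr hF
  rw [cos_triAngle ha hb hF, sin_triAngle ha hb]
  unfold faceHeight
  field_simp

/-- The dual area, written with the heights `hk` and `hl` of the two faces. -/
theorem dualArea_eq (h : IsGramPos a b c p q r) {u v w hk hl : ℝ}
    (hhk : hk = (v - u * Real.cos (triAngle a b p)) / Real.sin (triAngle a b p))
    (hhl : hl = (w - u * Real.cos (triAngle a c q)) / Real.sin (triAngle a c q)) :
    (1 / 2) * (hk * ((hl - hk * Real.cos (dihedralAngle a b c p q r))
          / Real.sin (dihedralAngle a b c p q r))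
        + hl * ((hk - hl * Real.cos (dihedralAngle a c b q p r))
          / Real.sin (dihedralAngle a c b q p r))) / a
      = 1 / 2 * dualRatio a b c p q r u v w := by
  have ha := h.ha
  unfold dualRatio
  split_ifs with hF
  · have hG := h.faceGram_pos_iff_left.mpr hF
    rw [h.height_eq hF] at hhk
    rw [h.swap_kl.height_eq hG] at hhl
    rw [h.cos_dihedralAngle hF, h.sin_dihedralAngle hF, h.swap_kl.cos_dihedralAngle hG,
      h.swap_kl.sin_dihedralAngle hG, hhk, hhl,
      (normalGram_relabel (a ^ 2) (b ^ 2) (c ^ 2) (p ^ 2) (q ^ 2) (r ^ 2)).2.1,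
      (tetGram_relabel (a ^ 2) (b ^ 2) (c ^ 2) (p ^ 2) (q ^ 2) (r ^ 2)).2.2.2.2.2.2]
    have hs := Real.sqrt_pos.mpr hF
    have ht := Real.sqrt_pos.mpr hG
    have hW := Real.sqrt_pos.mpr h.gram
    unfold dualCoeff
    have e₁ := Real.sq_sqrt hF.le
    have e₂ := Real.sq_sqrt hG.le
    generalize √(faceGram (a ^ 2) (b ^ 2) (p ^ 2)) = s at *
    generalize √(faceGram (a ^ 2) (c ^ 2) (q ^ 2)) = t at *
    rw [← e₁, ← e₂]
    field_simp
    ring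
  · have hG := h.faceGram_pos_iff_left.not.mpr hF
    rw [hhk, hhl, sin_triAngle_of_nonpos h.ha h.hb (not_lt.mp hF),
      sin_triAngle_of_nonpos h.ha h.hc (not_lt.mp hG)]
    simp

end IsGramPos

/-- `i`, `j`, `k`, `l` are the four vertices of a tetrahedron of the collection `𝒯`. -/
def IsTet {V : Type*} [DecidableEq V] (𝒯 : Finset (Finset V)) (i j k l : V) : Prop :=
  ({i, j, k, l} : Finset V) ∈ 𝒯 ∧ i ≠ j ∧ i ≠ k ∧ i ≠ l ∧ j ≠ k ∧ j ≠ l ∧ k ≠ l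

instance {V : Type*} [DecidableEq V] (𝒯 : Finset (Finset V)) (i j k l : V) :
    Decidable (IsTet 𝒯 i j k l) := by
  unfold IsTet; infer_instance

namespace IsTet

variable {V : Type*} [DecidableEq V] {𝒯 : Finset (Finset V)} {i j k l : V}

theorem swap_ij_iff : IsTet 𝒯 j i k l ↔ IsTet 𝒯 i j k l := by
  unfold IsTet
  rw [Finset.insert_comm j i]
  grind

theorem swap_jk_iff : IsTet 𝒯 i k j l ↔ IsTet 𝒯 i j k l := by
  unfold IsTet
  rw [Finset.insert_comm k j]
  grind

theorem swap_kl_iff : IsTet 𝒯 i j l k ↔ IsTet 𝒯 i j k l := by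
  unfold IsTet
  rw [Finset.pair_comm l k]
  grind

theorem isEdge (h : IsTet 𝒯 i j k l) : IsEdge 𝒯 i j :=
  ⟨h.2.1, _, h.1, by simp, by simp⟩

end IsTet

theorem IsEdge.symm {V : Type*} [DecidableEq V] {𝒯 : Finset (Finset V)} {i j : V}
    (h : IsEdge 𝒯 i j) : IsEdge 𝒯 j i :=
  ⟨h.1.symm, h.2.imp fun _ hT => ⟨hT.1, hT.2.2, hT.2.1⟩⟩

section TetSum

variable {V : Type*} [Fintype V] [DecidableEq V]

/-- The sum of `F` over the ordered edges of `𝒯`. -/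
def edgeSum (𝒯 : Finset (Finset V)) (F : V → V → ℝ) : ℝ :=
  ∑ i, ∑ j, if IsEdge 𝒯 i j then F i j else 0

/-- The sum of `F` over the ordered tetrahedra of `𝒯`. -/
def tetSum (𝒯 : Finset (Finset V)) (F : V → V → V → V → ℝ) : ℝ :=
  ∑ i, ∑ j, ∑ k, ∑ l, if IsTet 𝒯 i j k l then F i j k l else 0

variable {𝒯 : Finset (Finset V)}

theorem edgeSum_add (F G : V → V → ℝ) :
    edgeSum 𝒯 (fun i j => F i j + G i j) = edgeSum 𝒯 F + edgeSum 𝒯 G := by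
  unfold edgeSum
  simp only [← Finset.sum_add_distrib]
  refine Finset.sum_congr rfl fun i _ => Finset.sum_congr rfl fun j _ => ?_
  split_ifs <;> simp

theorem edgeSum_const_mul (c : ℝ) (F : V → V → ℝ) :
    edgeSum 𝒯 (fun i j => c * F i j) = c * edgeSum 𝒯 F := by
  unfold edgeSum
  simp only [Finset.mul_sum, mul_ite, mul_zero]

theorem edgeSum_congr {F G : V → V → ℝ} (h : ∀ i j, IsEdge 𝒯 i j → F i j = G i j) :
    edgeSum 𝒯 F = edgeSum 𝒯 G := by
  unfold edgeSum
  refine Finset.sum_congr rfl fun i _ => Finset.sum_congr rfl fun j _ => ?_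
  split_ifs with hE
  · exact h i j hE
  · rfl

theorem edgeSum_swap (F : V → V → ℝ) : edgeSum 𝒯 (fun i j => F j i) = edgeSum 𝒯 F := by
  unfold edgeSum
  rw [Finset.sum_comm]
  simp only [show ∀ i j, IsEdge 𝒯 j i ↔ IsEdge 𝒯 i j from
    fun i j => ⟨IsEdge.symm, IsEdge.symm⟩]

theorem tetSum_add (F G : V → V → V → V → ℝ) :
    tetSum 𝒯 (fun i j k l => F i j k l + G i j k l) = tetSum 𝒯 F + tetSum 𝒯 G := by
  unfold tetSum
  simp only [← Finset.sum_add_distrib]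
  refine Finset.sum_congr rfl fun i _ => Finset.sum_congr rfl fun j _ =>
    Finset.sum_congr rfl fun k _ => Finset.sum_congr rfl fun l _ => ?_
  split_ifs <;> simp

theorem tetSum_congr {F G : V → V → V → V → ℝ}
    (h : ∀ i j k l, IsTet 𝒯 i j k l → F i j k l = G i j k l) : tetSum 𝒯 F = tetSum 𝒯 G := by
  unfold tetSum
  refine Finset.sum_congr rfl fun i _ => Finset.sum_congr rfl fun j _ =>
    Finset.sum_congr rfl fun k _ => Finset.sum_congr rfl fun l _ => ?_
  split_ifs with hT
  · exact h i j k l hT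
  · rfl

theorem tetSum_swap_ij (F : V → V → V → V → ℝ) :
    tetSum 𝒯 (fun i j k l => F j i k l) = tetSum 𝒯 F := by
  unfold tetSum
  rw [Finset.sum_comm]
  simp only [IsTet.swap_ij_iff]

theorem tetSum_swap_jk (F : V → V → V → V → ℝ) :
    tetSum 𝒯 (fun i j k l => F i k j l) = tetSum 𝒯 F := by
  unfold tetSum
  refine Finset.sum_congr rfl fun i _ => ?_
  rw [Finset.sum_comm]
  simp only [IsTet.swap_jk_iff]

theorem tetSum_swap_kl (F : V → V → V → V → ℝ) :
    tetSum 𝒯 (fun i j k l => F i j l k) = tetSum 𝒯 F := by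
  unfold tetSum
  refine Finset.sum_congr rfl fun i _ => Finset.sum_congr rfl fun j _ => ?_
  rw [Finset.sum_comm]
  simp only [IsTet.swap_kl_iff]

/-- A sum over ordered tetrahedra vanishes if the contributions of the six edges of every
tetrahedron cancel. -/
theorem tetSum_eq_zero (F : V → V → V → V → ℝ)
    (h : ∀ i j k l, IsTet 𝒯 i j k l →
      F i j k l + F i k j l + F i l j k + F j k i l + F j l i k + F k l i j = 0) :
    tetSum 𝒯 F = 0 := by
  have h₂ := tetSum_swap_jk (𝒯 := 𝒯) F
  have h₃ : tetSum 𝒯 (fun i j k l => F i l j k) = tetSum 𝒯 F :=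
    (tetSum_swap_kl fun i j k l => F i k j l).trans h₂
  have h₄ : tetSum 𝒯 (fun i j k l => F j k i l) = tetSum 𝒯 F :=
    (tetSum_swap_ij fun i j k l => F i k j l).trans h₂
  have h₅ : tetSum 𝒯 (fun i j k l => F j l i k) = tetSum 𝒯 F :=
    (tetSum_swap_ij fun i j k l => F i l j k).trans h₃
  have h₆ : tetSum 𝒯 (fun i j k l => F k l i j) = tetSum 𝒯 F :=
    (tetSum_swap_jk fun i j k l => F j l i k).trans h₅
  have h₀ := tetSum_congr (𝒯 := 𝒯) (G := fun _ _ _ _ => 0) h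
  simp only [tetSum_add] at h₀
  rw [h₂, h₃, h₄, h₅, h₆] at h₀
  have : tetSum 𝒯 (fun _ _ _ _ => 0) = 0 := by simp [tetSum]
  linarith

theorem edgeSum_mul_sum (u : V → V → ℝ) (F : V → V → V → V → ℝ) :
    edgeSum 𝒯 (fun i j => u i j * ∑ k, ∑ l, if IsTet 𝒯 i j k l then F i j k l else 0)
      = tetSum 𝒯 fun i j k l => u i j * F i j k l := by
  unfold edgeSum tetSum
  refine Finset.sum_congr rfl fun i _ => Finset.sum_congr rfl fun j _ => ?_
  simp only [Finset.mul_sum, mul_ite, mul_zero]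
  split_ifs with h
  · rfl
  · symm
    exact Finset.sum_eq_zero fun k _ => Finset.sum_eq_zero fun l _ =>
      if_neg fun hT => h hT.isEdge

end TetSum

namespace Conformal3D

variable {V : Type*} [Fintype V] [DecidableEq V] {𝒯 : Finset (Finset V)}
  {U : Set (V → ℝ)} (C : Conformal3D V 𝒯 U) {f x : V → ℝ} {i j k l : V}

theorem len_comm (f : V → ℝ) (i j : V) : C.len f j i = C.len f i j := add_comm _ _

/-- The rate of change of `ℓ_ij` in the direction `x`. -/
noncomputable def lenSpeed (f x : V → ℝ) (i j : V) : ℝ := C.d f i j * x i + C.d f j i * x j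

theorem lenSpeed_comm (f x : V → ℝ) (i j : V) : C.lenSpeed f x j i = C.lenSpeed f x i j :=
  add_comm _ _

/-- The rate of change of `β_{ij,kl}` in the direction `x`. -/
noncomputable def betaSpeed (f x : V → ℝ) (i j k l : V) : ℝ :=
  dihedralSpeed (C.len f i j) (C.len f i k) (C.len f i l) (C.len f j k) (C.len f j l)
    (C.len f k l) (C.lenSpeed f x i j) (C.lenSpeed f x i k) (C.lenSpeed f x i l)
    (C.lenSpeed f x j k) (C.lenSpeed f x j l) (C.lenSpeed f x k l)

/-- Twice the dual area of `{i,j}` in the tetrahedron `{i,j,k,l}`, divided by `ℓ_ij`. -/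
noncomputable def tetDualRatio (f : V → ℝ) (i j k l : V) : ℝ :=
  dualRatio (C.len f i j) (C.len f i k) (C.len f i l) (C.len f j k) (C.len f j l)
    (C.len f k l) (C.d f i j) (C.d f i k) (C.d f i l)

theorem isGramPos (hf : f ∈ U) (h : IsTet 𝒯 i j k l) :
    IsGramPos (C.len f i j) (C.len f i k) (C.len f i l) (C.len f j k) (C.len f j l)
      (C.len f k l) where
  ha := C.lenPos f hf i j h.isEdge
  hb := C.lenPos f hf i k (IsTet.swap_jk_iff.mpr h).isEdge
  hc := C.lenPos f hf i l (IsTet.swap_jk_iff.mpr (IsTet.swap_kl_iff.mpr h)).isEdge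
  hp := C.lenPos f hf j k (IsTet.swap_jk_iff.mpr (IsTet.swap_ij_iff.mpr h)).isEdge
  hq := C.lenPos f hf j l
    (IsTet.swap_jk_iff.mpr (IsTet.swap_ij_iff.mpr (IsTet.swap_kl_iff.mpr h))).isEdge
  hr := C.lenPos f hf k l ⟨h.2.2.2.2.2.2, _, h.1, by simp, by simp⟩
  gram := by
    obtain ⟨hT, hij, hik, hil, hjk, hjl, hkl⟩ := h
    have := C.nondeg f hf _ hT i (by simp) j (by simp) k (by simp) l (by simp)
      hij hik hil hjk hjl hkl
    rw [cmDet_eq] at this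
    exact pos_of_mul_pos_right this (by norm_num)

theorem triangle_condition (hf : f ∈ U) (h : IsTet 𝒯 i j k l) :
    C.d f i j ^ 2 + C.d f j k ^ 2 + C.d f k i ^ 2
      = C.d f j i ^ 2 + C.d f k j ^ 2 + C.d f i k ^ 2 :=
  C.metricCond f hf _ h.1 i (by simp) j (by simp) k (by simp) h.2.1 h.2.2.1 h.2.2.2.2.1

theorem betaSpeed_swap (f x : V → ℝ) (i j k l : V) :
    C.betaSpeed f x j i k l = C.betaSpeed f x i j k l := by
  unfold betaSpeed
  rw [C.len_comm f i j, C.lenSpeed_comm f x i j]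
  exact dihedralSpeed_swap_ends _ _ _ _ _ _ _ _ _ _ _ _

theorem tetDualRatio_swap (hf : f ∈ U) (h : IsTet 𝒯 i j k l) :
    C.tetDualRatio f j i k l = C.tetDualRatio f i j k l := by
  unfold tetDualRatio
  rw [C.len_comm f i j]
  exact dualRatio_swap_ends (dki := C.d f k i) (dli := C.d f l i) (dkj := C.d f k j)
    (dlj := C.d f l j) rfl rfl rfl rfl rfl (C.triangle_condition hf h)
    (C.triangle_condition hf (IsTet.swap_kl_iff.mpr h))

theorem Aq_div_len (hf : f ∈ U) (h : IsTet 𝒯 i j k l) :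
    C.Aq f i j k l / C.len f i j = 1 / 2 * C.tetDualRatio f i j k l := by
  unfold Aq ht beta tetDualRatio
  rw [C.len_comm f k l]
  exact (C.isGramPos hf h).dualArea_eq rfl rfl

/-- The summed Schläfli formula. -/
theorem tetSum_len_mul_betaSpeed (hf : f ∈ U) (x : V → ℝ) :
    tetSum 𝒯 (fun i j k l => C.len f i j * C.betaSpeed f x i j k l) = 0 := by
  refine tetSum_eq_zero _ fun i j k l h => ?_
  unfold betaSpeed
  simp only [C.len_comm f j k, C.len_comm f i k, C.len_comm f i j, C.len_comm f i l,
    C.len_comm f j l, C.len_comm f k l, C.lenSpeed_comm f x j k, C.lenSpeed_comm f x i k,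
    C.lenSpeed_comm f x i j, C.lenSpeed_comm f x i l, C.lenSpeed_comm f x j l,
    C.lenSpeed_comm f x k l]
  exact (C.isGramPos hf h).sum_dihedralSpeed _ _ _ _ _ _

theorem tetSum_betaSpeed_mul_lenSpeed (hf : f ∈ U) (x : V → ℝ) :
    tetSum 𝒯 (fun i j k l => C.betaSpeed f x i j k l * C.lenSpeed f x i j
      + C.tetDualRatio f i j k l * (x i - x j) ^ 2) = 0 := by
  refine tetSum_eq_zero _ fun i j k l h => ?_
  have key := (C.isGramPos hf h).sum_dihedralSpeed_mul (xi := x i) (xj := x j) (xk := x k)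
    (xl := x l) (dij := C.d f i j) (dji := C.d f j i) (dik := C.d f i k) (dki := C.d f k i)
    (dil := C.d f i l) (dli := C.d f l i) (djk := C.d f j k) (dkj := C.d f k j)
    (djl := C.d f j l) (dlj := C.d f l j) (dkl := C.d f k l) (dlk := C.d f l k)
    rfl rfl rfl rfl rfl rfl (C.triangle_condition hf h)
    (C.triangle_condition hf (IsTet.swap_kl_iff.mpr h))
    (C.triangle_condition hf (IsTet.swap_kl_iff.mpr (IsTet.swap_jk_iff.mpr h)))
    rfl rfl rfl rfl rfl rfl
  unfold betaSpeed tetDualRatio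
  simp only [C.len_comm f j k, C.len_comm f i k, C.len_comm f i j, C.len_comm f i l,
    C.len_comm f j l, C.len_comm f k l, C.lenSpeed_comm f x j k, C.lenSpeed_comm f x i k,
    C.lenSpeed_comm f x i j, C.lenSpeed_comm f x i l, C.lenSpeed_comm f x j l,
    C.lenSpeed_comm f x k l]
  unfold lenSpeed
  linear_combination key

theorem tetSum_second_variation (hf : f ∈ U) (x : V → ℝ) :
    tetSum 𝒯 (fun i j k l => x i * C.d f i j * C.betaSpeed f x i j k l
      + C.Aq f i j k l / C.len f i j * (x j - x i) ^ 2) = 0 := by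
  have h₁ := C.tetSum_betaSpeed_mul_lenSpeed hf x
  set G : V → V → V → V → ℝ := fun i j k l => x i * C.d f i j * C.betaSpeed f x i j k l
      + C.Aq f i j k l / C.len f i j * (x j - x i) ^ 2 with hG
  have h₂ : tetSum 𝒯 (fun i j k l => G i j k l + G j i k l) = 0 := by
    rw [← h₁]
    refine tetSum_congr fun i j k l h => ?_
    simp only [hG]
    rw [C.Aq_div_len hf h, C.Aq_div_len hf (IsTet.swap_ij_iff.mpr h), C.betaSpeed_swap f x i j,
      C.tetDualRatio_swap hf h]
    unfold lenSpeed
    ring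
  rw [tetSum_add G fun i j k l => G j i k l, tetSum_swap_ij G] at h₂
  linarith

end Conformal3D

theorem IsGramPos.dihedralAngle_swap_ends {a b c p q r : ℝ} (h : IsGramPos a b c p q r) :
    dihedralAngle a p q b c r = dihedralAngle a b c p q r := by
  have e := (faceGram_relabel (a ^ 2) (b ^ 2) (p ^ 2)).2.1
  by_cases hF : 0 < faceGram (a ^ 2) (b ^ 2) (p ^ 2)
  · rw [h.dihedralAngle_eq hF, h.swap_ij.dihedralAngle_eq (by rwa [e]),
      (normalGram_relabel (a ^ 2) (b ^ 2) (c ^ 2) (p ^ 2) (q ^ 2) (r ^ 2)).1, e,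
      (faceGram_relabel (a ^ 2) (c ^ 2) (q ^ 2)).2.1]
  · rw [h.dihedralAngle_of_not_pos hF, h.swap_ij.dihedralAngle_of_not_pos (by rwa [e])]

namespace Conformal3D

variable {V : Type*} [Fintype V] [DecidableEq V] {𝒯 : Finset (Finset V)}
  {U : Set (V → ℝ)} (C : Conformal3D V 𝒯 U) {f x : V → ℝ} {i j k l : V}

theorem angSum_eq (f : V → ℝ) (i j : V) :
    C.angSum f i j
      = (1 / 2) * ∑ k, ∑ l, if IsTet 𝒯 i j k l then C.beta f i j k l else 0 := rfl

theorem dualLen_eq (f : V → ℝ) (i j : V) :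
    C.dualLen f i j
      = (1 / 2) * ∑ k, ∑ l, if IsTet 𝒯 i j k l then C.Aq f i j k l else 0 := rfl

theorem angSum_comm (hf : f ∈ U) (i j : V) : C.angSum f j i = C.angSum f i j := by
  rw [angSum_eq, angSum_eq]
  congr 1
  refine Finset.sum_congr rfl fun k _ => Finset.sum_congr rfl fun l _ => ?_
  rw [if_congr IsTet.swap_ij_iff rfl rfl]
  split_ifs with h
  · unfold beta
    rw [C.len_comm f i j]
    exact (C.isGramPos hf h).dihedralAngle_swap_ends
  · rfl

theorem differentiableAt_d (hf : f ∈ U) (h : IsEdge 𝒯 i j) :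
    DifferentiableAt ℝ (fun g => C.d g i j) f :=
  ((C.smooth i j h).contDiffAt (C.openU.mem_nhds hf)).differentiableAt (by simp)

theorem fderiv_d_apply (hf : f ∈ U) (h : IsEdge 𝒯 i j) (v : V → ℝ) :
    fderiv ℝ (fun g => C.d g i j) f v
      = v i * fderiv ℝ (fun g => C.d g i j) f (Pi.single i 1)
        + v j * fderiv ℝ (fun g => C.d g i j) f (Pi.single j 1) := by
  have hd := C.differentiableAt_d hf h
  rw [← smul_eq_mul, ← smul_eq_mul, ← map_smul, ← map_smul, ← map_add,
    ← hd.lineDeriv_eq_fderiv, ← hd.lineDeriv_eq_fderiv]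
  unfold lineDeriv
  congr 1
  funext t
  apply C.localDep i j h
  · simp [h.1]
  · simp [h.1.symm]

theorem hasDerivAt_comp_update {F : (V → ℝ) → ℝ} (hF : DifferentiableAt ℝ F f) (i : V) :
    HasDerivAt (fun s => F (Function.update f i s)) (fderiv ℝ F f (Pi.single i 1)) (f i) := by
  refine HasFDerivAt.comp_hasDerivAt (f i) ?_ (hasDerivAt_update f i (f i))
  rw [Function.update_eq_self]
  exact hF.hasFDerivAt

theorem fderiv_d_single_right (hf : f ∈ U) (h : IsEdge 𝒯 i j) :
    fderiv ℝ (fun g => C.d g i j) f (Pi.single j 1) = C.qq f i j :=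
  (hasDerivAt_comp_update (C.differentiableAt_d hf h) j).deriv.symm

theorem fderiv_d_single_left (hf : f ∈ U) (h : IsEdge 𝒯 i j) :
    fderiv ℝ (fun g => C.d g i j) f (Pi.single i 1) = C.d f i j - C.qq f j i := by
  rw [eq_sub_iff_add_eq, ← C.fderiv_d_single_right hf h.symm]
  exact ((hasDerivAt_comp_update (C.differentiableAt_d hf h) i).add
    (hasDerivAt_comp_update (C.differentiableAt_d hf h.symm) i)).unique (C.derivLen i j h f hf)

theorem hasFDerivAt_len (hf : f ∈ U) (h : IsEdge 𝒯 i j) :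
    HasFDerivAt (fun g => C.len g i j)
      (C.d f i j • ContinuousLinearMap.proj (R := ℝ) (φ := fun _ : V => ℝ) i
        + C.d f j i • ContinuousLinearMap.proj (R := ℝ) (φ := fun _ : V => ℝ) j) f := by
  refine ((C.differentiableAt_d hf h).hasFDerivAt.add
    (C.differentiableAt_d hf h.symm).hasFDerivAt).congr_fderiv ?_
  ext v
  simp only [_root_.add_apply, _root_.smul_apply,
    ContinuousLinearMap.proj_apply, smul_eq_mul]
  rw [C.fderiv_d_apply hf h, C.fderiv_d_apply hf h.symm, C.fderiv_d_single_left hf h,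
    C.fderiv_d_single_left hf h.symm, C.fderiv_d_single_right hf h,
    C.fderiv_d_single_right hf h.symm]
  ring

theorem qq_comm (hf : f ∈ U) (h : IsEdge 𝒯 i j) : C.qq f j i = C.qq f i j := by
  have key := second_derivative_symmetric_of_eventually
    (Filter.eventually_of_mem (C.openU.mem_nhds hf) fun g hg => C.hasFDerivAt_len hg h)
    (((C.differentiableAt_d hf h).hasFDerivAt.smul_const
      (ContinuousLinearMap.proj (R := ℝ) (φ := fun _ : V => ℝ) i)).add
    ((C.differentiableAt_d hf h.symm).hasFDerivAt.smul_const
      (ContinuousLinearMap.proj (R := ℝ) (φ := fun _ : V => ℝ) j)))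
    (Pi.single i 1) (Pi.single j 1)
  simp only [_root_.add_apply, ContinuousLinearMap.smulRight_apply,
    _root_.smul_apply, ContinuousLinearMap.proj_apply, smul_eq_mul,
    Pi.single_eq_same, Pi.single_eq_of_ne h.1, Pi.single_eq_of_ne h.1.symm, mul_one, mul_zero,
    zero_add, add_zero, C.fderiv_d_single_right hf h, C.fderiv_d_single_right hf h.symm] at key
  exact key

section Curve

variable {c : ℝ → V → ℝ} {t : ℝ}

theorem hasDerivAt_d (hc : HasDerivAt c x t) (hU : c t ∈ U) (h : IsEdge 𝒯 i j) :
    HasDerivAt (fun s => C.d (c s) i j)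
      ((C.d (c t) i j - C.qq (c t) i j) * x i + C.qq (c t) i j * x j) t := by
  refine ((C.differentiableAt_d hU h).hasFDerivAt.comp_hasDerivAt t hc).congr_deriv ?_
  rw [C.fderiv_d_apply hU h, C.fderiv_d_single_left hU h, C.fderiv_d_single_right hU h,
    C.qq_comm hU h]
  ring

theorem hasDerivAt_len (hc : HasDerivAt c x t) (hU : c t ∈ U) (h : IsEdge 𝒯 i j) :
    HasDerivAt (fun s => C.len (c s) i j) (C.lenSpeed (c t) x i j) t :=
  (C.hasFDerivAt_len hU h).comp_hasDerivAt t hc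

theorem hasDerivAt_beta (hc : HasDerivAt c x t) (hU : c t ∈ U) (h : IsTet 𝒯 i j k l) :
    HasDerivAt (fun s => C.beta (c s) i j k l) (C.betaSpeed (c t) x i j k l) t := by
  have hik := IsTet.swap_jk_iff.mpr h
  have hil := IsTet.swap_jk_iff.mpr (IsTet.swap_kl_iff.mpr h)
  have hjk := IsTet.swap_jk_iff.mpr (IsTet.swap_ij_iff.mpr h)
  have hjl := IsTet.swap_jk_iff.mpr (IsTet.swap_ij_iff.mpr (IsTet.swap_kl_iff.mpr h))
  exact hasDerivAt_dihedralAngle (C.hasDerivAt_len hc hU h.isEdge)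
    (C.hasDerivAt_len hc hU hik.isEdge) (C.hasDerivAt_len hc hU hil.isEdge)
    (C.hasDerivAt_len hc hU hjk.isEdge) (C.hasDerivAt_len hc hU hjl.isEdge)
    (C.hasDerivAt_len hc hU ⟨h.2.2.2.2.2.2, _, h.1, by simp, by simp⟩)
    ((hc.continuousAt.eventually (C.openU.mem_nhds hU)).mono fun s hs => C.isGramPos hs h)

theorem hasDerivAt_angSum (hc : HasDerivAt c x t) (hU : c t ∈ U) (i j : V) :
    HasDerivAt (fun s => C.angSum (c s) i j)
      ((1 / 2) * ∑ k, ∑ l, if IsTet 𝒯 i j k l then C.betaSpeed (c t) x i j k l else 0) t := by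
  refine HasDerivAt.const_mul _ (HasDerivAt.fun_sum fun k _ => HasDerivAt.fun_sum fun l _ => ?_)
  by_cases h : IsTet 𝒯 i j k l
  · have h' := h
    unfold IsTet at h'
    simp only [if_pos h, if_pos h']
    exact C.hasDerivAt_beta hc hU h
  · have h' := h
    unfold IsTet at h'
    simp only [if_neg h, if_neg h']
    exact hasDerivAt_const _ _

theorem hasDerivAt_edgeSum {F : ℝ → V → V → ℝ} {F' : V → V → ℝ}
    (h : ∀ i j, IsEdge 𝒯 i j → HasDerivAt (fun s => F s i j) (F' i j) t) :
    HasDerivAt (fun s => edgeSum 𝒯 (F s)) (edgeSum 𝒯 F') t := by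
  refine HasDerivAt.fun_sum fun i _ => HasDerivAt.fun_sum fun j _ => ?_
  split_ifs with hE
  · exact h i j hE
  · exact hasDerivAt_const _ _

theorem sum_Kv_mul (f x : V → ℝ) :
    ∑ i, C.Kv f i * x i
      = edgeSum 𝒯 fun i j => (2 * Real.pi - C.angSum f i j) * C.d f i j * x i := by
  unfold Kv edgeSum
  simp only [Finset.sum_mul, ite_mul, zero_mul]

/-- The first variation of the Einstein–Hilbert–Regge functional. -/
theorem hasDerivAt_EHR (hc : HasDerivAt c x t) (hU : c t ∈ U) :
    HasDerivAt (fun s => C.EHR (c s)) (∑ i, C.Kv (c t) i * x i) t := by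
  have h := (hasDerivAt_edgeSum (𝒯 := 𝒯) (F := fun s => C.Kedge (c s)) fun i j hE =>
    ((C.hasDerivAt_angSum hc hU i j).const_sub (2 * Real.pi)).mul
      (C.hasDerivAt_len hc hU hE)).const_mul (1 / 2 : ℝ)
  refine h.congr_deriv ?_
  rw [C.sum_Kv_mul]
  set G : V → V → ℝ := fun i j => (2 * Real.pi - C.angSum (c t) i j) * C.d (c t) i j * x i
    with hG
  have hS := C.tetSum_len_mul_betaSpeed hU x
  rw [← edgeSum_mul_sum] at hS
  rw [edgeSum_congr (G := fun i j => -(1 / 2) * (C.len (c t) i j * ∑ k, ∑ l,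
      if IsTet 𝒯 i j k l then C.betaSpeed (c t) x i j k l else 0) + (G i j + G j i)),
    edgeSum_add, edgeSum_const_mul, hS, edgeSum_add G fun i j => G j i, edgeSum_swap]
  · ring
  · intro i j _
    simp only [hG]
    rw [C.angSum_comm hU i j]
    unfold lenSpeed
    ring

/-- The derivative of the first variation. -/
theorem hasDerivAt_sum_Kv_mul {X : ℝ → V → ℝ} {y : V → ℝ} (hc : HasDerivAt c (X t) t)
    (hX : ∀ i, HasDerivAt (fun s => X s i) (y i) t) (hU : c t ∈ U) :
    HasDerivAt (fun s => ∑ i, C.Kv (c s) i * X s i)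
      (edgeSum 𝒯 (fun i j => (C.dualLen (c t) i j / C.len (c t) i j
          - C.qq (c t) i j / (2 * C.len (c t) i j) * C.Kedge (c t) i j)
            * (X t j - X t i) ^ 2)
        + ∑ i, C.Kv (c t) i * (X t i ^ 2 + y i)) t := by
  simp only [C.sum_Kv_mul]
  have h := hasDerivAt_edgeSum (𝒯 := 𝒯)
    (F := fun s i j => (2 * Real.pi - C.angSum (c s) i j) * C.d (c s) i j * X s i) fun i j hE =>
    (((C.hasDerivAt_angSum hc hU i j).const_sub (2 * Real.pi)).mul
      (C.hasDerivAt_d hc hU hE)).mul (hX i)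
  refine h.congr_deriv ?_
  generalize X t = x at *
  have hS := C.tetSum_second_variation hU x
  rw [tetSum_add, tetSum_congr (F := fun i j k l => C.Aq (c t) i j k l / C.len (c t) i j * _)
    (G := fun i j k l => (x j - x i) ^ 2 / C.len (c t) i j * C.Aq (c t) i j k l)
    fun i j k l _ => by ring, ← edgeSum_mul_sum, ← edgeSum_mul_sum] at hS
  set P : V → V → ℝ := fun i j => x i * C.d (c t) i j *
    ∑ k, ∑ l, if IsTet 𝒯 i j k l then C.betaSpeed (c t) x i j k l else 0 with hP
  set R : V → V → ℝ := fun i j => (x j - x i) ^ 2 / C.len (c t) i j *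
    ∑ k, ∑ l, if IsTet 𝒯 i j k l then C.Aq (c t) i j k l else 0 with hR
  set Q : V → V → ℝ := fun i j =>
    (2 * Real.pi - C.angSum (c t) i j) * C.qq (c t) i j * (x i * x j - x i ^ 2) with hQ
  set K : V → V → ℝ := fun i j =>
    (2 * Real.pi - C.angSum (c t) i j) * C.d (c t) i j * (x i ^ 2 + y i) with hK
  have hleft := edgeSum_congr (𝒯 := 𝒯) (F := fun i j =>
      (-(1 / 2 * ∑ k, ∑ l, if IsTet 𝒯 i j k l then C.betaSpeed (c t) x i j k l else 0)
          * C.d (c t) i j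
        + (2 * Real.pi - C.angSum (c t) i j)
          * ((C.d (c t) i j - C.qq (c t) i j) * x i + C.qq (c t) i j * x j)) * x i
        + (2 * Real.pi - C.angSum (c t) i j) * C.d (c t) i j * y i)
    (G := fun i j => -(1 / 2) * P i j + (Q i j + K i j)) fun i j _ => by
      simp only [hP, hQ, hK]
      ring
  have hright := edgeSum_congr (𝒯 := 𝒯) (F := fun i j =>
      (C.dualLen (c t) i j / C.len (c t) i j
        - C.qq (c t) i j / (2 * C.len (c t) i j) * C.Kedge (c t) i j) * (x j - x i) ^ 2)
    (G := fun i j => (1 / 2) * R i j + (1 / 2) * (Q i j + Q j i)) fun i j hE => by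
      have hlen : C.len (c t) i j ≠ 0 := (C.lenPos _ hU i j hE).ne'
      simp only [hR, hQ]
      rw [dualLen_eq, C.angSum_comm hU i j, C.qq_comm hU hE]
      unfold Kedge
      field_simp
      ring
  rw [edgeSum_add (fun i j => -(1 / 2) * P i j) fun i j => Q i j + K i j, edgeSum_const_mul,
    edgeSum_add Q K] at hleft
  rw [edgeSum_add (fun i j => (1 / 2) * R i j), edgeSum_const_mul, edgeSum_const_mul, edgeSum_add Q fun i j => Q j i,
    edgeSum_swap Q] at hright
  rw [hright]
  refine hleft.trans ?_
  linarith

end Curve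

end Conformal3D
open Conformal3D in
/-- Under a conformal variation `f(t)` of a three-dimensional conformal
structure, at `t = 0`:
`(d²/dt²) EHR = Σ_i Σ_{j : {i,j} edge} (ℓ*_ij/ℓ_ij − (q_ij/(2ℓ_ij)) K_ij)(f_j′ − f_i′)²
  + Σ_i K_i ((f_i′)² + f_i″)`;
in particular, in the Ricci flat case (`K_ij = 0` for all edges),
`(d²/dt²) EHR = Σ_i Σ_{j : {i,j} edge} (ℓ*_ij/ℓ_ij)(f_j′ − f_i′)²`. -/
theorem EHR_second_variation {V : Type*} [Fintype V] [DecidableEq V]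
    {𝒯 : Finset (Finset V)} {U : Set (V → ℝ)} (C : Conformal3D V 𝒯 U)
    (ε : ℝ) (hε : 0 < ε) (f : ℝ → (V → ℝ))
    (hmem : ∀ t ∈ Set.Ioo (-ε) ε, f t ∈ U)
    (hsmooth : ContDiffOn ℝ (⊤ : ℕ∞) f (Set.Ioo (-ε) ε)) :
    deriv (deriv (fun t => C.EHR (f t))) 0
      = (∑ i : V, ∑ j : V,
          if IsEdge 𝒯 i j then
            (C.dualLen (f 0) i j / C.len (f 0) i j
                - C.qq (f 0) i j / (2 * C.len (f 0) i j) * C.Kedge (f 0) i j)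
              * (deriv (fun t => f t j) 0 - deriv (fun t => f t i) 0) ^ 2
          else 0)
        + ∑ i : V, C.Kv (f 0) i
            * ((deriv (fun t => f t i) 0) ^ 2 + deriv (deriv (fun t => f t i)) 0)
    ∧ ((∀ i j : V, IsEdge 𝒯 i j → C.Kedge (f 0) i j = 0) →
        deriv (deriv (fun t => C.EHR (f t))) 0
          = ∑ i : V, ∑ j : V,
              if IsEdge 𝒯 i j then
                C.dualLen (f 0) i j / C.len (f 0) i j
                  * (deriv (fun t => f t j) 0 - deriv (fun t => f t i) 0) ^ 2
              else 0) := by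
  have h0 : (0 : ℝ) ∈ Set.Ioo (-ε) ε := ⟨neg_lt_zero.mpr hε, hε⟩
  have hc : ∀ t ∈ Set.Ioo (-ε) ε, HasDerivAt f (deriv f t) t := fun t ht =>
    ((hsmooth.contDiffAt (isOpen_Ioo.mem_nhds ht)).differentiableAt (by simp)).hasDerivAt
  have hcomp : ∀ t ∈ Set.Ioo (-ε) ε, ∀ i, deriv (fun s => f s i) t = deriv f t i :=
    fun t ht i => (hasDerivAt_pi.mp (hc t ht) i).deriv
  have hX : ∀ i, HasDerivAt (fun s => deriv (fun r => f r i) s)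
      (deriv (deriv fun r => f r i) 0) 0 := fun i =>
    ((((contDiffOn_pi.mp hsmooth i).deriv_of_isOpen (m := 1) isOpen_Ioo
      (by norm_cast)).contDiffAt (isOpen_Ioo.mem_nhds h0)).differentiableAt
        (by simp)).hasDerivAt
  have hEHR : deriv (fun t => C.EHR (f t))
      =ᶠ[nhds 0] fun t => ∑ i, C.Kv (f t) i * deriv (fun s => f s i) t := by
    filter_upwards [isOpen_Ioo.mem_nhds h0] with t ht
    simp only [(C.hasDerivAt_EHR (hc t ht) (hmem t ht)).deriv, hcomp t ht]
  have hc0 : HasDerivAt f (fun i => deriv (fun s => f s i) 0) 0 :=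
    (hc 0 h0).congr_deriv (funext fun i => (hcomp 0 h0 i).symm)
  have main := hEHR.deriv_eq.trans (C.hasDerivAt_sum_Kv_mul
    (X := fun t i => deriv (fun s => f s i) t) hc0 hX (hmem 0 h0)).deriv
  refine ⟨main, fun hflat => main.trans ?_⟩
  have hκ : ∀ i j, IsEdge 𝒯 i j → 2 * Real.pi - C.angSum (f 0) i j = 0 := fun i j hE =>
    (mul_eq_zero.mp (hflat i j hE)).resolve_right (C.lenPos _ (hmem 0 h0) i j hE).ne'
  have hKv : ∀ i, C.Kv (f 0) i = 0 := fun i => Finset.sum_eq_zero fun j _ => by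
    split_ifs with hE
    · rw [hκ i j hE, zero_mul]
    · rfl
  simp only [hKv, zero_mul, Finset.sum_const_zero, add_zero]
  exact edgeSum_congr fun i j hE => by rw [hflat i j hE, mul_zero, sub_zero]
end

section
/- Let r_i > 0 for i in a finite index set, and let η_ij = η_ji be reals with r_i² + r_j² + 2 r_i r_j η_ij > 0 for all i ≠ j. Define ℓ_ij = sqrt(r_i² + r_j² + 2 r_i r_j η_ij) and d_ij = r_i (r_i + r_j η_ij)/ℓ_ij. Then: (1) d_ij + d_ji = ℓ_ij for all i ≠ j; (2) for any three distinct indices i, j, k, the metric condition d_ij² + d_jk² + d_ki² = d_ji² + d_kj² + d_ik² holds; and (3) for f_i = log r_i, the lengths satisfy ∂ℓ_ij/∂f_i = d_ij, that is, r_i ∂ℓ_ij/∂r_i = d_ij. -/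
/-- The square root of the cosine-law quadratic is differentiable in the first radius. -/
theorem hasDerivAt_sqrt_inversive_length {a b e : ℝ}
    (h : 0 < a ^ 2 + b ^ 2 + 2 * a * b * e) :
    HasDerivAt (fun s : ℝ => Real.sqrt (s ^ 2 + b ^ 2 + 2 * s * b * e))
      ((a + b * e) / Real.sqrt (a ^ 2 + b ^ 2 + 2 * a * b * e)) a := by
  have hq : HasDerivAt (fun s : ℝ => s ^ 2 + b ^ 2 + 2 * s * b * e) (2 * a + 2 * b * e) a := by
    have h₁ : HasDerivAt (fun s : ℝ => s ^ 2 + b ^ 2) (2 * a) a := by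
      simpa using (hasDerivAt_pow 2 a).add_const (b ^ 2)
    have h₂ : HasDerivAt (fun s : ℝ => 2 * s * b * e) (2 * b * e) a := by
      simpa using (((hasDerivAt_id a).const_mul 2).mul_const b).mul_const e
    exact h₁.add h₂
  have hs := (Real.sqrt_pos.mpr h).ne'
  refine (hq.sqrt h.ne').congr_deriv ?_
  field_simp


/-- For radii `r i > 0` and inversive distances `η i j = η j i` with
`r i² + r j² + 2 r i r j η i j > 0`, the assignments
`ℓ i j = sqrt(r i² + r j² + 2 r i r j η i j)` and `d i j = r i (r i + r j η i j)/ℓ i j`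
satisfy: (1) `d i j + d j i = ℓ i j`; (2) the metric condition on every triple of
distinct indices; (3) with `f i = log (r i)`, `∂ℓ_ij/∂f_i = d i j`, i.e.
`r i ∂ℓ_ij/∂r i = d i j`. -/
theorem inversive_distance_is_conformal_structure
    {ι : Type*} (r : ι → ℝ) (hr : ∀ i, 0 < r i)
    (η : ι → ι → ℝ) (hsymm : ∀ i j : ι, η i j = η j i)
    (hpos : ∀ i j : ι, i ≠ j → 0 < r i ^ 2 + r j ^ 2 + 2 * r i * r j * η i j) :
    let L : ι → ι → ℝ := fun i j =>
      Real.sqrt (r i ^ 2 + r j ^ 2 + 2 * r i * r j * η i j)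
    let D : ι → ι → ℝ := fun i j => r i * (r i + r j * η i j) / L i j
    (∀ i j : ι, i ≠ j → D i j + D j i = L i j)
    ∧ (∀ i j k : ι, i ≠ j → j ≠ k → i ≠ k →
        D i j ^ 2 + D j k ^ 2 + D k i ^ 2 = D j i ^ 2 + D k j ^ 2 + D i k ^ 2)
    ∧ (∀ i j : ι, i ≠ j →
        HasDerivAt (fun s : ℝ =>
            Real.sqrt (Real.exp (2 * s) + r j ^ 2 + 2 * Real.exp s * r j * η i j))
          (D i j) (Real.log (r i))
        ∧ HasDerivAt (fun s : ℝ =>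
            Real.sqrt (s ^ 2 + r j ^ 2 + 2 * s * r j * η i j))
          (D i j / r i) (r i)) := by
  intro L D
  have hLpos : ∀ i j, i ≠ j → 0 < L i j := fun i j hij => Real.sqrt_pos.mpr (hpos i j hij)
  have hLsq : ∀ i j, i ≠ j → L i j ^ 2 = r i ^ 2 + r j ^ 2 + 2 * r i * r j * η i j :=
    fun i j hij => Real.sq_sqrt (hpos i j hij).le
  have hLsymm : ∀ i j, L j i = L i j := fun i j => by
    change Real.sqrt _ = Real.sqrt _
    rw [hsymm j i]
    ring_nf
  have hadd : ∀ i j, i ≠ j → D i j + D j i = L i j := fun i j hij => by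
    change r i * (r i + r j * η i j) / L i j + r j * (r j + r i * η j i) / L j i = L i j
    rw [hLsymm i j, hsymm j i, ← add_div, div_eq_iff (hLpos i j hij).ne']
    linear_combination -hLsq i j hij
  have hsub : ∀ i j, i ≠ j → D i j ^ 2 - D j i ^ 2 = r i ^ 2 - r j ^ 2 := fun i j hij => by
    have hdiff : D i j - D j i = (r i ^ 2 - r j ^ 2) / L i j := by
      change r i * (r i + r j * η i j) / L i j - r j * (r j + r i * η j i) / L j i = _
      rw [hLsymm i j, hsymm j i]
      ring
    rw [sq_sub_sq, hadd i j hij, hdiff, mul_div_cancel₀ _ (hLpos i j hij).ne']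
  refine ⟨hadd, fun i j k hij hjk hik => ?_, fun i j hij => ⟨?_, ?_⟩⟩
  · linear_combination hsub i j hij + hsub j k hjk - hsub i k hik
  · have hexp : Real.exp (Real.log (r i)) = r i := Real.exp_log (hr i)
    have h := hasDerivAt_sqrt_inversive_length (hpos i j hij)
    rw [← hexp] at h
    have hc := h.comp (Real.log (r i)) (Real.hasDerivAt_exp (Real.log (r i)))
    rw [hexp] at hc
    refine (hc.congr_deriv ?_).congr_of_eventuallyEq (.of_forall fun s => ?_)
    · change _ = r i * (r i + r j * η i j) / Real.sqrt _
      ring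
    · simp only [Function.comp_apply, ← Real.exp_nat_mul, Nat.cast_ofNat]
  · refine (hasDerivAt_sqrt_inversive_length (hpos i j hij)).congr_deriv ?_
    change _ = r i * (r i + r j * η i j) / Real.sqrt _ / r i
    rw [mul_div_assoc, mul_div_cancel_left₀ _ (hr i).ne']
end

section
/- Let r_i, r_j > 0 and η_ij ∈ ℝ with r_i² + r_j² + 2 r_i r_j η_ij > 0, and set ℓ_ij = sqrt(r_i² + r_j² + 2 r_i r_j η_ij) and d_ij = r_i (r_i + r_j η_ij)/ℓ_ij. Then q_ij := ∂d_ij/∂f_j, where f_j = log r_j (i.e., q_ij = r_j ∂d_ij/∂r_j), satisfies q_ij = r_i² r_j² (η_ij² − 1)/ℓ_ij³. In particular q_ij is symmetric in i and j, q_ij ≤ 0 when |η_ij| ≤ 1, and q_ij = 0 in the sphere packing case η_ij = 1. -/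
/-- The partial derivative of `d = a (a + s η) / ℓ` in the second radius `s`. -/
lemma hasDerivAt_inversive_distance_d {a b η : ℝ}
    (hpos : 0 < a ^ 2 + b ^ 2 + 2 * a * b * η) :
    HasDerivAt (fun s : ℝ => a * (a + s * η) / Real.sqrt (a ^ 2 + s ^ 2 + 2 * a * s * η))
      (a ^ 2 * b * (η ^ 2 - 1) / Real.sqrt (a ^ 2 + b ^ 2 + 2 * a * b * η) ^ 3) b := by
  have hnum : HasDerivAt (fun s : ℝ => a * (a + s * η)) (a * η) b := by
    simpa using (((hasDerivAt_id b).mul_const η).const_add a).const_mul a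
  have hrad : HasDerivAt (fun s : ℝ => a ^ 2 + s ^ 2 + 2 * a * s * η)
      (2 * b + 2 * a * η) b := by
    simpa using ((hasDerivAt_pow 2 b).const_add (a ^ 2)).fun_add
      (((hasDerivAt_id b).const_mul (2 * a)).mul_const η)
  have hℓ := Real.sqrt_pos.mpr hpos
  have hsq := Real.sq_sqrt hpos.le
  refine (hnum.div (hrad.sqrt hpos.ne') hℓ.ne').congr_deriv ?_
  generalize Real.sqrt (a ^ 2 + b ^ 2 + 2 * a * b * η) = ℓ at hℓ hsq ⊢
  field_simp
  rw [hsq]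
  ring

/-- In the fixed inversive distance conformal structure with
`ℓ = sqrt(r_i² + r_j² + 2 r_i r_j η)` and `d_ij = r_i (r_i + r_j η)/ℓ`, the quantity
`q_ij = ∂d_ij/∂f_j = r_j ∂d_ij/∂r_j` equals `r_i² r_j² (η² − 1)/ℓ³`. In particular it
is symmetric in `i` and `j`, nonpositive when `|η| ≤ 1`, and zero in the sphere
packing case `η = 1`. -/
theorem inversive_distance_q_formula
    (ri rj ηij : ℝ) (hri : 0 < ri) (hrj : 0 < rj)
    (hpos : 0 < ri ^ 2 + rj ^ 2 + 2 * ri * rj * ηij) :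
    let ℓ := Real.sqrt (ri ^ 2 + rj ^ 2 + 2 * ri * rj * ηij)
    let Q := ri ^ 2 * rj ^ 2 * (ηij ^ 2 - 1) / ℓ ^ 3
    rj * deriv (fun s : ℝ =>
        ri * (ri + s * ηij) / Real.sqrt (ri ^ 2 + s ^ 2 + 2 * ri * s * ηij)) rj = Q
    ∧ ri * deriv (fun s : ℝ =>
        rj * (rj + s * ηij) / Real.sqrt (rj ^ 2 + s ^ 2 + 2 * rj * s * ηij)) ri = Q
    ∧ (|ηij| ≤ 1 → Q ≤ 0)
    ∧ (ηij = 1 → Q = 0) := by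
  intro ℓ Q
  refine ⟨?_, ?_, fun h => ?_, fun h => ?_⟩
  · rw [(hasDerivAt_inversive_distance_d hpos).deriv]
    simp only [Q, ℓ]
    ring
  · have hsymm : rj ^ 2 + ri ^ 2 + 2 * rj * ri * ηij = ri ^ 2 + rj ^ 2 + 2 * ri * rj * ηij := by
      ring
    rw [(hasDerivAt_inversive_distance_d (hsymm ▸ hpos)).deriv, hsymm]
    simp only [Q, ℓ]
    ring
  · have hη : ηij ^ 2 - 1 ≤ 0 := sub_nonpos.mpr ((sq_le_one_iff_abs_le_one ηij).mpr h)
    exact div_nonpos_of_nonpos_of_nonneg (mul_nonpos_of_nonneg_of_nonpos (by positivity) hη)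
      (pow_nonneg (Real.sqrt_nonneg _) 3)
  · simp [Q, h]
end
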